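/- There exists exactly one function H : [0,∞) → ℝ that is continuous on [0,∞), twice continuously differentiable on (0,∞), and satisfies H''(x) + f(H(x)) = 0 for all x > 0, H(0) = 0, 0 ≤ H(x) < 1 for all x ≥ 0, and H(x) → 1 as x → ∞. -/

import Mathlib

open Set Filter Topology

/-- The primitive `F(s) = ∫₀^s f(r) dr`. -/
noncomputable def F (f : ℝ → ℝ) (s : ℝ) : ℝ := ∫ r in (0:ℝ)..s, f r

/-- Bistable nonlinearity with balanced-positive integral. -/
def Bistable (f : ℝ → ℝ) (a : ℝ) : Prop :=
  ContDiff ℝ 1 f ∧ 0 < a ∧ a < 1 ∧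
  f 0 = 0 ∧ f a = 0 ∧ f 1 = 0 ∧
  (∀ s, 0 < s → s < a → f s < 0) ∧
  (∀ s, a < s → s < 1 → 0 < f s) ∧
  deriv f 0 < 0 ∧ 0 < deriv f a ∧ deriv f 1 < 0 ∧
  0 < ∫ s in (0:ℝ)..(1:ℝ), f s


/-- `H` is the stable-manifold profile: continuous on `[0,∞)`, C² on `(0,∞)`,
solves `H'' + f(H) = 0` on `(0,∞)`, `H(0) = 0`, `0 ≤ H < 1`, `H → 1` at `∞`. -/
def IsH (f : ℝ → ℝ) (H : ℝ → ℝ) : Prop :=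
  ContinuousOn H (Ici 0) ∧ ContDiffOn ℝ 2 H (Ioi 0) ∧
  (∀ x : ℝ, 0 < x → deriv (deriv H) x + f (H x) = 0) ∧
  H 0 = 0 ∧ (∀ x : ℝ, 0 ≤ x → 0 ≤ H x ∧ H x < 1) ∧
  Tendsto H atTop (𝓝 1)

/-- The potential gap `F(1) - F(s)`. -/
noncomputable def potentialGap (f : ℝ → ℝ) (s : ℝ) : ℝ := F f 1 - F f s

/-- The speed of the orbit of the stable manifold of `(1, 0)` at height `s`. -/
noncomputable def orbitSpeed (f : ℝ → ℝ) (s : ℝ) : ℝ := √(2 * potentialGap f s)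

/-- The time needed to climb from height `0` to height `s`. -/
noncomputable def travelTime (f : ℝ → ℝ) (s : ℝ) : ℝ := ∫ r in (0:ℝ)..s, (orbitSpeed f r)⁻¹

theorem hasDerivAt_F {f : ℝ → ℝ} (hf : Continuous f) (s : ℝ) : HasDerivAt (F f) (f s) s :=
  intervalIntegral.integral_hasDerivAt_right (hf.intervalIntegrable _ _)
    (hf.stronglyMeasurableAtFilter _ _) hf.continuousAt

theorem hasDerivAt_potentialGap {f : ℝ → ℝ} (hf : Continuous f) (s : ℝ) :
    HasDerivAt (potentialGap f) (-f s) s :=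
  (hasDerivAt_F hf s).const_sub _

theorem continuous_potentialGap {f : ℝ → ℝ} (hf : Continuous f) : Continuous (potentialGap f) :=
  continuous_iff_continuousAt.2 fun s => (hasDerivAt_potentialGap hf s).continuousAt

theorem continuous_orbitSpeed {f : ℝ → ℝ} (hf : Continuous f) : Continuous (orbitSpeed f) :=
  ((continuous_potentialGap hf).const_mul 2).sqrt

theorem Bistable.continuous {f : ℝ → ℝ} {a : ℝ} (hf : Bistable f a) : Continuous f :=
  hf.1.continuous

theorem Bistable.potentialGap_pos {f : ℝ → ℝ} {a : ℝ} (hf : Bistable f a) {s : ℝ}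
    (hs : s ∈ Ico (0:ℝ) 1) : 0 < potentialGap f s := by
  have hc := hf.continuous
  obtain ⟨-, ha0, ha1, -, -, -, hneg, hpos, -, -, -, hint⟩ := hf
  have hF : Continuous (F f) := continuous_iff_continuousAt.2 fun s => (hasDerivAt_F hc s).continuousAt
  have hd : deriv (F f) = f := funext fun s => (hasDerivAt_F hc s).deriv
  have hint : 0 < F f 1 := hint
  have h0 : F f 0 = 0 := by simp [F]
  unfold potentialGap
  rcases le_total s a with h | h
  · have hanti : StrictAntiOn (F f) (Icc 0 a) := by
      refine strictAntiOn_of_deriv_neg (convex_Icc _ _) hF.continuousOn fun x hx => ?_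
      rw [interior_Icc] at hx
      rw [hd]; exact hneg x hx.1 hx.2
    have := hanti.antitoneOn ⟨le_rfl, ha0.le⟩ ⟨hs.1, h⟩ hs.1
    linarith
  · have hmono : StrictMonoOn (F f) (Icc a 1) := by
      refine strictMonoOn_of_deriv_pos (convex_Icc _ _) hF.continuousOn fun x hx => ?_
      rw [interior_Icc] at hx
      rw [hd]; exact hpos x hx.1 hx.2
    have := hmono ⟨h, hs.2.le⟩ ⟨ha1.le, le_rfl⟩ hs.2
    linarith

theorem Bistable.orbitSpeed_pos {f : ℝ → ℝ} {a : ℝ} (hf : Bistable f a) {s : ℝ}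
    (hs : s ∈ Ico (0:ℝ) 1) : 0 < orbitSpeed f s :=
  Real.sqrt_pos.2 (mul_pos two_pos (hf.potentialGap_pos hs))

theorem Bistable.hasDerivAt_orbitSpeed {f : ℝ → ℝ} {a : ℝ} (hf : Bistable f a) {s : ℝ}
    (hs : s ∈ Ico (0:ℝ) 1) : HasDerivAt (orbitSpeed f) (-f s / orbitSpeed f s) s := by
  have h := ((hasDerivAt_potentialGap hf.continuous s).const_mul 2).sqrt
    (mul_pos two_pos (hf.potentialGap_pos hs)).ne'
  have hp := hf.orbitSpeed_pos hs
  refine h.congr_deriv ?_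
  change 2 * -f s / (2 * orbitSpeed f s) = _
  field_simp

theorem Bistable.hasDerivAt_travelTime {f : ℝ → ℝ} {a : ℝ} (hf : Bistable f a) {s : ℝ}
    (hs : s ∈ Ico (0:ℝ) 1) : HasDerivAt (travelTime f) (orbitSpeed f s)⁻¹ s := by
  have hc := continuous_orbitSpeed hf.continuous
  refine intervalIntegral.integral_hasDerivAt_right ?_ ?_
    (hc.continuousAt.inv₀ (hf.orbitSpeed_pos hs).ne')
  · refine ContinuousOn.intervalIntegrable fun r hr => ?_
    rw [uIcc_of_le hs.1] at hr
    exact (hc.continuousAt.inv₀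
      (hf.orbitSpeed_pos ⟨hr.1, hr.2.trans_lt hs.2⟩).ne').continuousWithinAt
  · exact hc.measurable.inv.stronglyMeasurable.stronglyMeasurableAtFilter

theorem Bistable.strictMonoOn_travelTime {f : ℝ → ℝ} {a : ℝ} (hf : Bistable f a) :
    StrictMonoOn (travelTime f) (Ico 0 1) := by
  refine strictMonoOn_of_deriv_pos (convex_Ico _ _)
    (fun s hs => (hf.hasDerivAt_travelTime hs).continuousAt.continuousWithinAt) fun s hs => ?_
  have hs' := interior_subset hs
  rw [(hf.hasDerivAt_travelTime hs').deriv]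
  exact inv_pos.2 (hf.orbitSpeed_pos hs')

@[simp] theorem travelTime_zero (f : ℝ → ℝ) : travelTime f 0 = 0 := by simp [travelTime]

theorem Bistable.exists_orbitSpeed_le {f : ℝ → ℝ} {a : ℝ} (hf : Bistable f a) :
    ∃ c, 0 < c ∧ ∀ s ∈ Ico (0:ℝ) 1, orbitSpeed f s ≤ c * (1 - s) := by
  have hc := hf.continuous
  obtain ⟨C, hC⟩ := (isCompact_Icc (a := (0:ℝ)) (b := 1)).exists_bound_of_continuousOn
    (hf.1.continuous_deriv le_rfl).continuousOn
  set L := max C 1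
  have hL : 0 < L := lt_max_of_lt_right one_pos
  have hlip : ∀ s ∈ Icc (0:ℝ) 1, f s ≤ L * (1 - s) := fun s hs => by
    have h := (convex_Icc (0:ℝ) 1).norm_image_sub_le_of_norm_deriv_le (f := f) (C := L)
      (fun x _ => (hf.1.differentiable one_ne_zero) x)
      (fun x hx => (hC x hx).trans (le_max_left _ _)) ⟨zero_le_one, le_rfl⟩ hs
    rw [hf.2.2.2.2.2.1, sub_zero, Real.norm_eq_abs, Real.norm_eq_abs, abs_sub_comm,
      abs_of_nonneg (sub_nonneg.2 hs.2)] at h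
    exact (le_abs_self _).trans h
  have hd : ∀ s, HasDerivAt (fun s => potentialGap f s - L * (1 - s) ^ 2 / 2)
      (-f s + L * (1 - s)) s := fun s => by
    have h := (((((hasDerivAt_id' s).const_sub 1).pow 2).const_mul L).div_const 2)
    refine ((hasDerivAt_potentialGap hc s).sub h).congr_deriv ?_
    push_cast; ring
  have hmono : MonotoneOn (fun s => potentialGap f s - L * (1 - s) ^ 2 / 2) (Icc 0 1) := by
    refine monotoneOn_of_deriv_nonneg (convex_Icc _ _)
      (fun s _ => (hd s).continuousAt.continuousWithinAt)
      (fun s _ => (hd s).differentiableAt.differentiableWithinAt) fun s hs => ?_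
    rw [(hd s).deriv]
    linarith [hlip s (interior_subset hs)]
  refine ⟨√L, Real.sqrt_pos.2 hL, fun s hs => ?_⟩
  have h := hmono ⟨hs.1, hs.2.le⟩ ⟨zero_le_one, le_rfl⟩ hs.2.le
  simp only [potentialGap, sub_self] at h
  refine Real.sqrt_le_iff.2 ⟨mul_nonneg (Real.sqrt_nonneg _) (sub_nonneg.2 hs.2.le), ?_⟩
  rw [mul_pow, Real.sq_sqrt hL.le]
  simp only [potentialGap]
  linarith

theorem Bistable.exists_le_travelTime {f : ℝ → ℝ} {a : ℝ} (hf : Bistable f a) {M : ℝ}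
    (hM : 0 ≤ M) : ∃ s ∈ Ico (0:ℝ) 1, M ≤ travelTime f s := by
  obtain ⟨c, hc, hle⟩ := hf.exists_orbitSpeed_le
  have hd : ∀ s ∈ Ico (0:ℝ) 1, HasDerivAt (fun s => travelTime f s + Real.log (1 - s) / c)
      ((orbitSpeed f s)⁻¹ + -1 / (1 - s) / c) s := fun s hs =>
    (hf.hasDerivAt_travelTime hs).add
      ((((hasDerivAt_id' s).const_sub 1).log (sub_pos.2 hs.2).ne').div_const c)
  have hmono : MonotoneOn (fun s => travelTime f s + Real.log (1 - s) / c) (Ico 0 1) := by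
    refine monotoneOn_of_deriv_nonneg (convex_Ico _ _)
      (fun s hs => (hd s hs).continuousAt.continuousWithinAt)
      (fun s hs => (hd s (interior_subset hs)).differentiableAt.differentiableWithinAt)
      fun s hs => ?_
    have hs' := interior_subset hs
    have h1 : 0 < 1 - s := sub_pos.2 hs'.2
    rw [(hd s hs').deriv]
    have h2 := inv_anti₀ (hf.orbitSpeed_pos hs') (hle s hs')
    have h3 : -1 / (1 - s) / c = -(c * (1 - s))⁻¹ := by field_simp
    rw [h3]; linarith
  have hs : 1 - Real.exp (-(c * M)) ∈ Ico (0:ℝ) 1 :=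
    ⟨sub_nonneg.2 (Real.exp_le_one_iff.2 (neg_nonpos.2 (by positivity))),
      sub_lt_self _ (Real.exp_pos _)⟩
  refine ⟨_, hs, ?_⟩
  have h := hmono ⟨le_rfl, one_pos⟩ hs hs.1
  simp only [travelTime_zero, sub_zero, Real.log_one, zero_div, add_zero, sub_sub_cancel,
    Real.log_exp] at h
  have h3 : -(c * M) / c = -M := by field_simp
  rw [h3] at h; linarith

theorem Bistable.exists_travelTime_eq {f : ℝ → ℝ} {a : ℝ} (hf : Bistable f a) {x : ℝ}
    (hx : 0 ≤ x) : ∃ s ∈ Ico (0:ℝ) 1, travelTime f s = x := by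
  obtain ⟨b, hb, hxb⟩ := hf.exists_le_travelTime hx
  have hcont : ContinuousOn (travelTime f) (Icc 0 b) := fun s hs =>
    (hf.hasDerivAt_travelTime ⟨hs.1, hs.2.trans_lt hb.2⟩).continuousAt.continuousWithinAt
  obtain ⟨s, hs, h⟩ := intermediate_value_Icc hb.1 hcont
    (show x ∈ Icc _ _ from ⟨by rwa [travelTime_zero], hxb⟩)
  exact ⟨s, ⟨hs.1, hs.2.trans_lt hb.2⟩, h⟩

theorem Bistable.exists_isH {f : ℝ → ℝ} {a : ℝ} (hf : Bistable f a) : ∃ H : ℝ → ℝ, IsH f H := by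
  have hmono := hf.strictMonoOn_travelTime
  choose H hmem hH using fun x : ℝ => hf.exists_travelTime_eq (le_max_right x 0)
  have lower : ∀ {b x : ℝ}, b ∈ Ico (0:ℝ) 1 → travelTime f b < x → b < H x := fun {b x} hb h =>
    (hmono.lt_iff_lt hb (hmem x)).1 (by rw [hH]; exact h.trans_le (le_max_left _ _))
  have hcont : Continuous H := by
    refine continuous_iff_continuousAt.2 fun x => tendsto_order.2 ⟨fun b hb => ?_, fun b hb => ?_⟩
    · rcases lt_or_ge b 0 with h | h
      · exact Eventually.of_forall fun y => h.trans_le (hmem y).1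
      · have hb1 : b ∈ Ico (0:ℝ) 1 := ⟨h, hb.trans (hmem x).2⟩
        have ht := (hmono.lt_iff_lt hb1 (hmem x)).2 hb
        rw [hH] at ht
        filter_upwards [(continuous_id.max continuous_const).continuousAt.eventually
          (lt_mem_nhds ht)] with y hy
        exact (hmono.lt_iff_lt hb1 (hmem y)).1 (by rw [hH]; exact hy)
    · rcases le_or_gt 1 b with h | h
      · exact Eventually.of_forall fun y => (hmem y).2.trans_le h
      · have hb1 : b ∈ Ico (0:ℝ) 1 := ⟨(hmem x).1.trans hb.le, h⟩
        have ht := (hmono.lt_iff_lt (hmem x) hb1).2 hb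
        rw [hH] at ht
        filter_upwards [(continuous_id.max continuous_const).continuousAt.eventually
          (gt_mem_nhds ht)] with y hy
        exact (hmono.lt_iff_lt (hmem y) hb1).1 (by rw [hH]; exact hy)
  have hd : ∀ x ∈ Ioi (0:ℝ), HasDerivAt H (orbitSpeed f (H x)) x := fun x hx => by
    have h := HasDerivAt.of_local_left_inverse hcont.continuousAt
      (hf.hasDerivAt_travelTime (hmem x)) (inv_pos.2 (hf.orbitSpeed_pos (hmem x))).ne' (by
        filter_upwards [Ioi_mem_nhds hx] with y hy
        rw [hH, max_eq_left (le_of_lt hy)])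
    rwa [inv_inv] at h
  have hd2 : ∀ x ∈ Ioi (0:ℝ), HasDerivAt (deriv H) (-f (H x)) x := fun x hx => by
    have h := ((hf.hasDerivAt_orbitSpeed (hmem x)).comp x (hd x hx)).congr_deriv
      (div_mul_cancel₀ _ (hf.orbitSpeed_pos (hmem x)).ne')
    refine h.congr_of_eventuallyEq ?_
    filter_upwards [Ioi_mem_nhds hx] with y hy using (hd y hy).deriv
  refine ⟨H, hcont.continuousOn, ?_, fun x hx => ?_, ?_, fun x _ => hmem x, ?_⟩
  · rw [show (2 : WithTop ℕ∞) = 1 + 1 by norm_num,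
      contDiffOn_succ_iff_deriv_of_isOpen isOpen_Ioi]
    refine ⟨fun x hx => (hd x hx).differentiableAt.differentiableWithinAt, by simp, ?_⟩
    rw [show (1 : WithTop ℕ∞) = 0 + 1 by norm_num,
      contDiffOn_succ_iff_deriv_of_isOpen isOpen_Ioi]
    refine ⟨fun x hx => (hd2 x hx).differentiableAt.differentiableWithinAt, by simp, ?_⟩
    rw [contDiffOn_zero]
    exact (hf.continuous.comp hcont).neg.continuousOn.congr fun x hx => (hd2 x hx).deriv
  · rw [(hd2 x hx).deriv, neg_add_cancel]
  · refine hmono.injOn (hmem 0) ⟨le_rfl, one_pos⟩ ?_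
    rw [hH, travelTime_zero, max_self]
  · refine tendsto_order.2 ⟨fun b hb => ?_, fun b hb => ?_⟩
    · have hb' : max b 0 ∈ Ico (0:ℝ) 1 := ⟨le_max_right _ _, max_lt hb one_pos⟩
      filter_upwards [eventually_gt_atTop (travelTime f (max b 0))] with x hx
      exact (le_max_left _ _).trans_lt (lower hb' hx)
    · exact Eventually.of_forall fun x => (hmem x).2.trans hb

theorem IsH.hasDerivAt {f H : ℝ → ℝ} (h : IsH f H) {x : ℝ} (hx : x ∈ Ioi (0:ℝ)) :
    HasDerivAt H (deriv H x) x :=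
  ((h.2.1.differentiableOn two_ne_zero).differentiableAt (Ioi_mem_nhds hx)).hasDerivAt

theorem IsH.hasDerivAt_deriv {f H : ℝ → ℝ} (h : IsH f H) {x : ℝ} (hx : x ∈ Ioi (0:ℝ)) :
    HasDerivAt (deriv H) (-f (H x)) x := by
  have hC := h.2.1
  rw [show (2 : WithTop ℕ∞) = 1 + 1 by norm_num,
    contDiffOn_succ_iff_deriv_of_isOpen isOpen_Ioi] at hC
  have hd := ((hC.2.2.differentiableOn one_ne_zero).differentiableAt (Ioi_mem_nhds hx)).hasDerivAt
  exact hd.congr_deriv (eq_neg_of_add_eq_zero_left (h.2.2.1 x hx))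

theorem IsH.sq_deriv_eq {f H : ℝ → ℝ} (hf : Continuous f) (h : IsH f H) {x : ℝ}
    (hx : x ∈ Ioi (0:ℝ)) : deriv H x ^ 2 = 2 * potentialGap f (H x) := by
  have hE : ∀ y ∈ Ioi (0:ℝ),
      HasDerivAt (fun y => deriv H y ^ 2 - 2 * potentialGap f (H y)) 0 y := fun y hy => by
    refine (((h.hasDerivAt_deriv hy).pow 2).sub
      (((hasDerivAt_potentialGap hf (H y)).comp y (h.hasDerivAt hy)).const_mul 2)).congr_deriv ?_
    push_cast; ring
  obtain ⟨k, hk⟩ := isOpen_Ioi.exists_is_const_of_deriv_eq_zero isPreconnected_Ioi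
    (fun y hy => (hE y hy).differentiableAt.differentiableWithinAt) (fun y hy => (hE y hy).deriv)
  have hlim : Tendsto (fun y => deriv H y ^ 2) atTop (𝓝 k) := by
    have h1 : Tendsto (fun y => k + 2 * potentialGap f (H y)) atTop
        (𝓝 (k + 2 * potentialGap f 1)) :=
      ((((continuous_potentialGap hf).tendsto 1).comp h.2.2.2.2.2).const_mul 2).const_add k
    rw [potentialGap, sub_self, mul_zero, add_zero] at h1
    refine h1.congr' ?_
    filter_upwards [eventually_gt_atTop 0] with y hy
    rw [← hk y hy]; ring
  have hmvt : ∀ y : ℝ, ∃ z, y ≤ z ∧ (0 < y → deriv H z = H (y + 1) - H y) := fun y => by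
    by_cases hy : 0 < y
    · obtain ⟨z, hz, hz'⟩ := exists_deriv_eq_slope H (lt_add_one y)
        (h.1.mono fun w hw => hy.le.trans hw.1)
        (fun w hw => (h.hasDerivAt (hy.trans hw.1)).differentiableAt.differentiableWithinAt)
      exact ⟨z, hz.1.le, fun _ => by rw [hz', add_sub_cancel_left, div_one]⟩
    · exact ⟨y, le_rfl, fun h' => absurd h' hy⟩
  choose z hz hzd using hmvt
  have h0 : Tendsto (fun y => (H (y + 1) - H y) ^ 2) atTop (𝓝 ((1 - 1) ^ 2)) :=
    ((h.2.2.2.2.2.comp (tendsto_atTop_add_const_right _ 1 tendsto_id)).sub h.2.2.2.2.2).pow 2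
  have h1 : Tendsto (fun y => (H (y + 1) - H y) ^ 2) atTop (𝓝 k) := by
    refine (hlim.comp (tendsto_atTop_mono hz tendsto_id)).congr' ?_
    filter_upwards [eventually_gt_atTop 0] with y hy
    rw [Function.comp_apply, hzd y hy]
  have hk0 : k = 0 := by rw [tendsto_nhds_unique h1 h0]; norm_num
  have := hk x hx
  rw [hk0] at this
  linarith

theorem IsH.deriv_eq {f H : ℝ → ℝ} {a : ℝ} (hf : Bistable f a) (h : IsH f H) {x : ℝ}
    (hx : x ∈ Ioi (0:ℝ)) : deriv H x = orbitSpeed f (H x) := by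
  have hmem : ∀ y ∈ Ioi (0:ℝ), H y ∈ Ico (0:ℝ) 1 := fun y hy => h.2.2.2.2.1 y (le_of_lt hy)
  have hsq : ∀ y ∈ Ioi (0:ℝ), deriv H y ^ 2 = orbitSpeed f (H y) ^ 2 := fun y hy => by
    rw [h.sq_deriv_eq hf.continuous hy, orbitSpeed,
      Real.sq_sqrt (mul_pos two_pos (hf.potentialGap_pos (hmem y hy))).le]
  obtain ⟨b, hb0, hb⟩ : ∃ b, 0 < b ∧ 0 < H b :=
    ((eventually_gt_atTop 0).and (h.2.2.2.2.2.eventually (lt_mem_nhds one_pos))).exists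
  obtain ⟨y, hy, hy'⟩ := exists_deriv_eq_slope H hb0 (h.1.mono Icc_subset_Ici_self)
    (fun w hw => (h.hasDerivAt hw.1).differentiableAt.differentiableWithinAt)
  have hpos : 0 < deriv H y := by
    rw [hy', h.2.2.2.1, sub_zero, sub_zero]; exact div_pos hb hb0
  refine isPreconnected_Ioi.eq_of_sq_eq
    (fun w hw => (h.hasDerivAt_deriv hw).continuousAt.continuousWithinAt)
    (((continuous_orbitSpeed hf.continuous).comp_continuousOn
      (h.1.mono Ioi_subset_Ici_self))) (fun w hw => hsq w hw)
    (fun hw => (hf.orbitSpeed_pos (hmem _ hw)).ne') (y := y) hy.1 ?_ hx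
  exact (pow_left_inj₀ hpos.le (Real.sqrt_nonneg _) two_ne_zero).1 (hsq y hy.1)

theorem IsH.travelTime_eq {f H : ℝ → ℝ} {a : ℝ} (hf : Bistable f a) (h : IsH f H) {x : ℝ}
    (hx : 0 ≤ x) : travelTime f (H x) = x := by
  have hmem := h.2.2.2.2.1
  have hcont : ContinuousOn (fun y => travelTime f (H y) - y) (Icc 0 x) := fun y hy =>
    ((hf.hasDerivAt_travelTime (hmem y hy.1)).continuousAt.comp_continuousWithinAt
      ((h.1 y hy.1).mono Icc_subset_Ici_self)).sub continuousWithinAt_id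
  have hd : ∀ y ∈ Ioo 0 x, HasDerivAt (fun y => travelTime f (H y) - y) 0 y := fun y hy => by
    have hd := h.hasDerivAt hy.1
    rw [h.deriv_eq hf hy.1] at hd
    refine (((hf.hasDerivAt_travelTime (hmem y hy.1.le)).comp y hd).sub
      (hasDerivAt_id' y)).congr_deriv ?_
    rw [inv_mul_cancel₀ (hf.orbitSpeed_pos (hmem y hy.1.le)).ne', sub_self]
  rcases hx.eq_or_lt with rfl | hx0
  · rw [h.2.2.2.1, travelTime_zero]
  · obtain ⟨y, hy, hy'⟩ := exists_hasDerivAt_eq_slope _ _ hx0 hcont hd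
    rw [eq_comm, div_eq_zero_iff, h.2.2.2.1, travelTime_zero] at hy'
    rcases hy' with hy' | hy' <;> linarith

/-- There exists exactly one function `H` on `[0,∞)` with the stated properties. -/
theorem H_exists_unique (f : ℝ → ℝ) (a : ℝ) (hf : Bistable f a) :
    (∃ H : ℝ → ℝ, IsH f H) ∧
    (∀ H₁ H₂ : ℝ → ℝ, IsH f H₁ → IsH f H₂ → EqOn H₁ H₂ (Ici 0)) := by
  refine ⟨hf.exists_isH, fun H₁ H₂ h₁ h₂ x hx => ?_⟩
  refine hf.strictMonoOn_travelTime.injOn (h₁.2.2.2.2.1 x hx) (h₂.2.2.2.2.1 x hx) ?_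
  rw [h₁.travelTime_eq hf hx, h₂.travelTime_eq hf hx]
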